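/- For complex numbers τ, σ with Im τ > 0 and Im σ > 0, the function u(z) = Γ̄(z, τ, σ) satisfies the functional equation u(z+1) = (θ₀(τz, σ)/θ₀(τ, σ)) · u(z) for all z where both sides are defined, together with the normalization u(1) = 1. -/

import Mathlib

open Complex Real Filter

/-- The q-Pochhammer infinite product `(x; q) = ∏_{j=0}^∞ (1 - x q^j)`. -/
noncomputable def qPoch (x q : ℂ) : ℂ := ∏' j : ℕ, (1 - x * q ^ j)

/-- The Jacobi theta function `θ₀(z,τ) = (x;q)(q/x;q)` with `x = e^{2πiz}`, `q = e^{2πiτ}`. -/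
noncomputable def theta₀ (z τ : ℂ) : ℂ :=
  qPoch (Complex.exp (2 * Real.pi * Complex.I * z)) (Complex.exp (2 * Real.pi * Complex.I * τ)) *
  qPoch (Complex.exp (2 * Real.pi * Complex.I * τ) / Complex.exp (2 * Real.pi * Complex.I * z))
    (Complex.exp (2 * Real.pi * Complex.I * τ))

/-- The elliptic gamma function
`Γ(z,τ,σ) = ∏_{j,k≥0} (1 - e^{2πi((j+1)τ+(k+1)σ-z)}) / (1 - e^{2πi(jτ+kσ+z)})`. -/
noncomputable def ellipticGamma (z τ σ : ℂ) : ℂ :=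
  ∏' p : ℕ × ℕ,
    (1 - Complex.exp (2 * Real.pi * Complex.I *
        (((p.1 : ℂ) + 1) * τ + ((p.2 : ℂ) + 1) * σ - z))) /
    (1 - Complex.exp (2 * Real.pi * Complex.I * ((p.1 : ℂ) * τ + (p.2 : ℂ) * σ + z)))

/-- All denominator factors of the product defining `Γ(z,τ,σ)` are nonzero. -/
def EllipticGammaDefined (z τ σ : ℂ) : Prop :=
  ∀ j k : ℕ, Complex.exp (2 * Real.pi * Complex.I * ((j : ℂ) * τ + (k : ℂ) * σ + z)) ≠ 1

/-- The normalized elliptic gamma function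
`Γ̄(z,τ,σ) = ((q;q)/(r;r)) θ₀(τ,σ)^{1-z} Γ(zτ,τ,σ)` with `q = e^{2πiτ}`, `r = e^{2πiσ}`;
the power is the principal-branch complex power. -/
noncomputable def ellipticGammaBar (z τ σ : ℂ) : ℂ :=
  (qPoch (Complex.exp (2 * Real.pi * Complex.I * τ)) (Complex.exp (2 * Real.pi * Complex.I * τ)) /
   qPoch (Complex.exp (2 * Real.pi * Complex.I * σ)) (Complex.exp (2 * Real.pi * Complex.I * σ))) *
  theta₀ τ σ ^ (1 - z) * ellipticGamma (z * τ) τ σ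

/-- Jackson's q-gamma function `Γ_q(z) = (1-q)^{1-z} (q;q)/(q^z;q)`, `q = e^{2πiτ}`,
with principal-branch powers. -/
noncomputable def qGammaTrig (z τ : ℂ) : ℂ :=
  (1 - Complex.exp (2 * Real.pi * Complex.I * τ)) ^ (1 - z) *
    qPoch (Complex.exp (2 * Real.pi * Complex.I * τ)) (Complex.exp (2 * Real.pi * Complex.I * τ)) /
    qPoch (Complex.exp (2 * Real.pi * Complex.I * τ * z)) (Complex.exp (2 * Real.pi * Complex.I * τ))

/-- The double q-Pochhammer product `∏_{j,k≥0} (1 - a q^j r^k)`. -/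
noncomputable def doubleQPoch (a q r : ℂ) : ℂ := ∏' p : ℕ × ℕ, (1 - a * (q ^ p.1 * r ^ p.2))

section DoubleQPoch

variable {a q r : ℂ}

lemma summable_norm_neg_mul_pow_mul_pow (a : ℂ) (hq : ‖q‖ < 1) (hr : ‖r‖ < 1) :
    Summable fun p : ℕ × ℕ ↦ ‖-(a * (q ^ p.1 * r ^ p.2))‖ := by
  have h : Summable fun p : ℕ × ℕ ↦ ‖q ^ p.1 * r ^ p.2‖ := by
    have hq' : Summable fun n : ℕ ↦ ‖q ^ n‖ := by
      simpa using summable_geometric_of_lt_one (norm_nonneg q) hq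
    have hr' : Summable fun n : ℕ ↦ ‖r ^ n‖ := by
      simpa using summable_geometric_of_lt_one (norm_nonneg r) hr
    exact (summable_mul_of_summable_norm hq' hr').norm
  simpa using h.mul_left ‖a‖

lemma multipliable_doubleQPoch (a : ℂ) (hq : ‖q‖ < 1) (hr : ‖r‖ < 1) :
    Multipliable fun p : ℕ × ℕ ↦ 1 - a * (q ^ p.1 * r ^ p.2) := by
  simpa [sub_eq_add_neg] using
    multipliable_one_add_of_summable (summable_norm_neg_mul_pow_mul_pow a hq hr)

lemma doubleQPoch_ne_zero (hq : ‖q‖ < 1) (hr : ‖r‖ < 1)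
    (ha : ∀ j k : ℕ, a * (q ^ j * r ^ k) ≠ 1) : doubleQPoch a q r ≠ 0 := by
  have h := tprod_one_add_ne_zero_of_summable
    (f := fun p : ℕ × ℕ ↦ -(a * (q ^ p.1 * r ^ p.2)))
    (fun p ↦ by rw [← sub_eq_add_neg]; exact sub_ne_zero.2 (ha p.1 p.2).symm)
    (summable_norm_neg_mul_pow_mul_pow a hq hr)
  simpa only [doubleQPoch, sub_eq_add_neg] using h

lemma doubleQPoch_ne_zero_of_norm_lt_one (ha : ‖a‖ < 1) (hq : ‖q‖ < 1) (hr : ‖r‖ < 1) :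
    doubleQPoch a q r ≠ 0 := by
  refine doubleQPoch_ne_zero hq hr fun j k h ↦ ?_
  have hlt : ‖a * (q ^ j * r ^ k)‖ < 1 := by
    rw [norm_mul, norm_mul, norm_pow, norm_pow]
    exact mul_lt_one_of_nonneg_of_lt_one_left (norm_nonneg a) ha
      (mul_le_one₀ (pow_le_one₀ (norm_nonneg q) hq.le) (by positivity)
        (pow_le_one₀ (norm_nonneg r) hr.le))
  simp [h] at hlt

lemma doubleQPoch_comm (a q r : ℂ) : doubleQPoch a q r = doubleQPoch a r q := by
  rw [doubleQPoch, doubleQPoch, ← (Equiv.prodComm ℕ ℕ).tprod_eq]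
  simp [mul_comm]

lemma hasProd_qPoch_doubleQPoch (a : ℂ) (hq : ‖q‖ < 1) (hr : ‖r‖ < 1) :
    HasProd (fun j : ℕ ↦ qPoch (a * q ^ j) r) (doubleQPoch a q r) := by
  refine (multipliable_doubleQPoch a hq hr).hasProd.prod_fiberwise fun j ↦ ?_
  have h := multipliable_one_add_of_summable
    ((summable_norm_neg_mul_pow_mul_pow a hq hr).prod_factor j)
  simpa only [qPoch, ← sub_eq_add_neg, mul_assoc] using h.hasProd

lemma doubleQPoch_eq_qPoch_mul (a : ℂ) (hq : ‖q‖ < 1) (hr : ‖r‖ < 1) :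
    doubleQPoch a q r = qPoch a r * doubleQPoch (a * q) q r := by
  have h : HasProd (fun j : ℕ ↦ qPoch (a * q ^ (j + 1)) r) (doubleQPoch (a * q) q r) := by
    have := hasProd_qPoch_doubleQPoch (a * q) hq hr
    simp_rw [mul_assoc, ← pow_succ'] at this
    exact this
  have h₀ := tprod_eq_zero_mul' (f := fun j : ℕ ↦ qPoch (a * q ^ j) r) h.multipliable
  rwa [(hasProd_qPoch_doubleQPoch a hq hr).tprod_eq, h.tprod_eq, pow_zero, mul_one] at h₀

lemma doubleQPoch_eq_qPoch_mul' (a : ℂ) (hq : ‖q‖ < 1) (hr : ‖r‖ < 1) :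
    doubleQPoch a q r = qPoch a q * doubleQPoch (a * r) q r := by
  rw [doubleQPoch_comm, doubleQPoch_eq_qPoch_mul a hr hq, doubleQPoch_comm]

end DoubleQPoch

lemma Complex.norm_exp_two_pi_I_mul_lt_one {τ : ℂ} (hτ : 0 < τ.im) :
    ‖Complex.exp (2 * Real.pi * Complex.I * τ)‖ < 1 := by
  simpa using UpperHalfPlane.norm_exp_two_pi_I_lt_one ⟨τ, hτ⟩

lemma exp_lattice_add (z τ σ : ℂ) (j k : ℕ) :
    Complex.exp (2 * Real.pi * Complex.I * ((j : ℂ) * τ + (k : ℂ) * σ + z)) =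
      Complex.exp (2 * Real.pi * Complex.I * z) *
        (Complex.exp (2 * Real.pi * Complex.I * τ) ^ j *
          Complex.exp (2 * Real.pi * Complex.I * σ) ^ k) := by
  rw [← Complex.exp_nat_mul, ← Complex.exp_nat_mul, ← Complex.exp_add, ← Complex.exp_add]
  ring_nf

lemma EllipticGammaDefined.doubleQPoch_ne_zero {z τ σ : ℂ} (h : EllipticGammaDefined z τ σ)
    (hτ : 0 < τ.im) (hσ : 0 < σ.im) :
    doubleQPoch (Complex.exp (2 * Real.pi * Complex.I * z))
      (Complex.exp (2 * Real.pi * Complex.I * τ)) (Complex.exp (2 * Real.pi * Complex.I * σ)) ≠ 0 :=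
  _root_.doubleQPoch_ne_zero (norm_exp_two_pi_I_mul_lt_one hτ) (norm_exp_two_pi_I_mul_lt_one hσ)
    fun j k ↦ exp_lattice_add z τ σ j k ▸ h j k

lemma ellipticGamma_eq_div {z τ σ : ℂ} (hτ : 0 < τ.im) (hσ : 0 < σ.im)
    (hz : doubleQPoch (Complex.exp (2 * Real.pi * Complex.I * z))
      (Complex.exp (2 * Real.pi * Complex.I * τ))
      (Complex.exp (2 * Real.pi * Complex.I * σ)) ≠ 0) :
    ellipticGamma z τ σ =
      doubleQPoch (Complex.exp (2 * Real.pi * Complex.I * (τ + σ - z)))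
        (Complex.exp (2 * Real.pi * Complex.I * τ)) (Complex.exp (2 * Real.pi * Complex.I * σ)) /
      doubleQPoch (Complex.exp (2 * Real.pi * Complex.I * z))
        (Complex.exp (2 * Real.pi * Complex.I * τ))
        (Complex.exp (2 * Real.pi * Complex.I * σ)) := by
  have hq := norm_exp_two_pi_I_mul_lt_one hτ
  have hr := norm_exp_two_pi_I_mul_lt_one hσ
  unfold doubleQPoch at hz ⊢
  rw [← (multipliable_doubleQPoch _ hq hr).tprod_div₀ (multipliable_doubleQPoch _ hq hr) hz,
    ellipticGamma]
  refine tprod_congr fun p ↦ ?_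
  rw [← exp_lattice_add, ← exp_lattice_add]
  ring_nf

lemma ellipticGamma_add {z τ σ : ℂ} (hτ : 0 < τ.im) (hσ : 0 < σ.im)
    (hz : EllipticGammaDefined z τ σ) (hz' : EllipticGammaDefined (z + τ) τ σ) :
    ellipticGamma (z + τ) τ σ = theta₀ z σ * ellipticGamma z τ σ := by
  have hq := norm_exp_two_pi_I_mul_lt_one hτ
  have hr := norm_exp_two_pi_I_mul_lt_one hσ
  have h := hz.doubleQPoch_ne_zero hτ hσ
  rw [ellipticGamma_eq_div hτ hσ h, ellipticGamma_eq_div hτ hσ (hz'.doubleQPoch_ne_zero hτ hσ),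
    theta₀, ← Complex.exp_sub, ← mul_sub]
  have hnum : τ + σ - (z + τ) = σ - z := by ring
  have hnum' : τ + σ - z = (σ - z) + τ := by ring
  rw [hnum, hnum', mul_add _ (σ - z) τ, mul_add _ z τ, Complex.exp_add, Complex.exp_add,
    doubleQPoch_eq_qPoch_mul (Complex.exp (2 * Real.pi * Complex.I * (σ - z))) hq hr]
  rw [doubleQPoch_eq_qPoch_mul _ hq hr] at h ⊢
  obtain ⟨h₁, h₂⟩ := mul_ne_zero_iff.1 h
  rw [doubleQPoch_eq_qPoch_mul (Complex.exp (2 * Real.pi * Complex.I * z)) hq hr]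
  field_simp

/-- `Γ̄` satisfies `u(z+1) = (θ₀(τz,σ)/θ₀(τ,σ)) u(z)` and `u(1) = 1`. -/
theorem ellipticGammaBar_shift_and_normalization (τ σ : ℂ) (hτ : 0 < τ.im) (hσ : 0 < σ.im) :
    (∀ z : ℂ, EllipticGammaDefined (z * τ) τ σ → EllipticGammaDefined ((z + 1) * τ) τ σ →
      ellipticGammaBar (z + 1) τ σ =
        theta₀ (τ * z) σ / theta₀ τ σ * ellipticGammaBar z τ σ) ∧
    ellipticGammaBar 1 τ σ = 1 := by
  have hq := norm_exp_two_pi_I_mul_lt_one hτ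
  have hr := norm_exp_two_pi_I_mul_lt_one hσ
  refine ⟨fun z hz hz' ↦ ?_, ?_⟩
  · have hz₀ : z ≠ 0 := by
      rintro rfl
      simpa using hz 0 0
    have hpow : theta₀ τ σ ^ (1 - (z + 1)) = theta₀ τ σ ^ (1 - z) / theta₀ τ σ := by
      rcases eq_or_ne (theta₀ τ σ) 0 with hθ | hθ
      · rw [hθ, div_zero, Complex.zero_cpow]
        simpa using hz₀
      · rw [← sub_sub, Complex.cpow_sub _ _ hθ, Complex.cpow_one]
    rw [add_mul, one_mul] at hz'
    rw [ellipticGammaBar, ellipticGammaBar, hpow, add_mul, one_mul, ellipticGamma_add hτ hσ hz hz',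
      mul_comm τ z]
    ring
  · have hτ₀ := doubleQPoch_ne_zero_of_norm_lt_one hq hq hr
    have hσ₀ := doubleQPoch_ne_zero_of_norm_lt_one hr hq hr
    rw [ellipticGammaBar, sub_self, Complex.cpow_zero, mul_one, one_mul,
      ellipticGamma_eq_div hτ hσ hτ₀, add_sub_cancel_left]
    have hτ₁ := doubleQPoch_eq_qPoch_mul' (exp (2 * Real.pi * Complex.I * τ)) hq hr
    have hσ₁ := doubleQPoch_eq_qPoch_mul (exp (2 * Real.pi * Complex.I * σ)) hq hr
    rw [mul_comm (exp (2 * Real.pi * Complex.I * σ)) (exp (2 * Real.pi * Complex.I * τ))] at hσ₁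
    rw [hτ₁] at hτ₀
    rw [hσ₁] at hσ₀
    rw [hτ₁, hσ₁]
    obtain ⟨h₁, h₂⟩ := mul_ne_zero_iff.1 hτ₀
    obtain ⟨h₃, -⟩ := mul_ne_zero_iff.1 hσ₀
    field_simp
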